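/- Let Σ be a finite alphabet, φ : Σ* → Σ* a nonerasing morphism, and a ∈ Σ a letter of order ∞ such that φ(a) = aγ for some nonempty γ ∈ Σ*. Then the pure morphic sequence α = φ^∞(a) contains infinitely many occurrences of letters of order ∞. -/

import Mathlib

open Asymptotics Filter

/-- Apply a morphism (given by its values on letters) to a finite word. -/
def substWord {A : Type*} (φ : A → List A) : List A → List A
  | [] => []
  | a :: w => φ a ++ substWord φ w

/-- The `n`-th iterate of a morphism applied to a word. -/
def iterWord {A : Type*} (φ : A → List A) (n : ℕ) (w : List A) : List A :=
  (substWord φ)^[n] w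

/-- The letter `b` has order `∞`: `|φ^n(b)| = Ω(q^n)` for some real `q > 1`. -/
def HasOrderInf {A : Type*} (φ : A → List A) (b : A) : Prop :=
  ∃ q : ℝ, 1 < q ∧
    (fun n => q ^ n) =O[atTop] (fun n => ((iterWord φ n [b]).length : ℝ))

section Growth

variable {A : Type*} {φ : A → List A}

lemma substWord_append (u v : List A) :
    substWord φ (u ++ v) = substWord φ u ++ substWord φ v := by
  induction u with
  | nil => rfl
  | cons a u ih => simp [substWord, ih]

lemma iterWord_succ (n : ℕ) (w : List A) :
    iterWord φ (n + 1) w = iterWord φ n (substWord φ w) := rfl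

lemma iterWord_add (m n : ℕ) (w : List A) :
    iterWord φ (m + n) w = iterWord φ m (iterWord φ n w) :=
  Function.iterate_add_apply _ m n w

lemma iterWord_append (n : ℕ) (u v : List A) :
    iterWord φ n (u ++ v) = iterWord φ n u ++ iterWord φ n v := by
  induction n generalizing u v with
  | zero => rfl
  | succ n ih => simp only [iterWord_succ, substWord_append, ih]

lemma iterWord_nil (n : ℕ) : iterWord φ n [] = [] := by
  induction n with
  | zero => rfl
  | succ n ih => exact ih

lemma iterWord_cons (n : ℕ) (b : A) (w : List A) :
    iterWord φ n (b :: w) = iterWord φ n [b] ++ iterWord φ n w :=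
  iterWord_append n [b] w

lemma substWord_singleton (b : A) : substWord φ [b] = φ b := by
  simp [substWord]

lemma sublist_iterWord_of_mem {c : A} {w : List A} (h : c ∈ w) (n : ℕ) :
    (iterWord φ n [c]).Sublist (iterWord φ n w) := by
  obtain ⟨s, t, rfl⟩ := List.append_of_mem h
  rw [iterWord_append, iterWord_cons n c t]
  exact (List.sublist_append_left _ _).trans (List.sublist_append_right _ _)

lemma mem_iterWord_add {b c d : A} {m n : ℕ} (hc : c ∈ iterWord φ n [b])
    (hd : d ∈ iterWord φ m [c]) : d ∈ iterWord φ (m + n) [b] := by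
  rw [iterWord_add]
  exact (sublist_iterWord_of_mem hc m).subset hd

lemma length_le_of_mem_iterWord {b c : A} {r : ℕ} (h : c ∈ iterWord φ r [b]) (n : ℕ) :
    (iterWord φ n [c]).length ≤ (iterWord φ (n + r) [b]).length := by
  rw [iterWord_add]
  exact (sublist_iterWord_of_mem h n).length_le

lemma length_le_substWord (hφ : ∀ b, φ b ≠ []) (w : List A) :
    w.length ≤ (substWord φ w).length := by
  induction w with
  | nil => simp
  | cons b w ih =>
    have := List.length_pos_iff.2 (hφ b)
    simp only [substWord, List.length_append, List.length_cons]
    omega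

lemma length_iterWord_mono (hφ : ∀ b, φ b ≠ []) (w : List A) :
    Monotone fun n => (iterWord φ n w).length := by
  refine monotone_nat_of_le_succ fun n => ?_
  rw [add_comm n 1, iterWord_add]
  exact length_le_substWord hφ _

lemma length_iterWord_singleton_pos (hφ : ∀ b, φ b ≠ []) (b : A) (n : ℕ) :
    1 ≤ (iterWord φ n [b]).length :=
  length_iterWord_mono hφ [b] (Nat.zero_le n)

/-- A word whose iterated images grow more slowly than every exponential. -/
def Subexponential (φ : A → List A) (w : List A) : Prop :=
  ∀ q : ℝ, 1 < q → ∃ C : ℝ, ∀ n, ((iterWord φ n w).length : ℝ) ≤ C * q ^ n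

lemma Subexponential.append {u v : List A} (hu : Subexponential φ u)
    (hv : Subexponential φ v) : Subexponential φ (u ++ v) := by
  intro q hq
  obtain ⟨C, hC⟩ := hu q hq
  obtain ⟨D, hD⟩ := hv q hq
  refine ⟨C + D, fun n => ?_⟩
  rw [iterWord_append, List.length_append, Nat.cast_add, add_mul]
  exact add_le_add (hC n) (hD n)

lemma subexponential_of_forall_mem {w : List A} (h : ∀ c ∈ w, Subexponential φ [c]) :
    Subexponential φ w := by
  induction w with
  | nil => exact fun q _ => ⟨0, fun n => by simp [iterWord_nil]⟩
  | cons b w ih =>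
    exact (h b (by simp)).append (ih fun c hc => h c (by simp [hc]))

/-- If some iterate of `b` is `b` together with letters of subexponential growth, then `b` has
subexponential growth. -/
lemma subexponential_of_length_add {b : A} {w : List A} {m : ℕ} (hm : 0 < m)
    (hw : Subexponential φ w)
    (h : ∀ n, (iterWord φ (n + m) [b]).length =
      (iterWord φ n [b]).length + (iterWord φ n w).length) :
    Subexponential φ [b] := by
  intro q hq
  obtain ⟨C, hC⟩ := hw q hq
  have hqm : 0 < q ^ m - 1 := sub_pos.2 (one_lt_pow₀ hq hm.ne')
  set S : ℝ := ∑ i ∈ Finset.range m, ((iterWord φ i [b]).length : ℝ) with hS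
  have hS0 : 0 ≤ S := Finset.sum_nonneg fun _ _ => Nat.cast_nonneg _
  have hC0 : 0 ≤ C := by simpa using (Nat.cast_nonneg _).trans (hC 0)
  have hD0 : 0 ≤ C / (q ^ m - 1) := div_nonneg hC0 hqm.le
  have hD : C / (q ^ m - 1) * (q ^ m - 1) = C := div_mul_cancel₀ _ hqm.ne'
  refine ⟨S + C / (q ^ m - 1), fun n => ?_⟩
  induction n using Nat.strong_induction_on with
  | _ n ih =>
    rcases lt_or_ge n m with hn | hn
    · have h1 : ((iterWord φ n [b]).length : ℝ) ≤ S :=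
        Finset.single_le_sum (f := fun i => ((iterWord φ i [b]).length : ℝ))
          (fun _ _ => Nat.cast_nonneg _) (Finset.mem_range.2 hn)
      calc ((iterWord φ n [b]).length : ℝ) ≤ S + C / (q ^ m - 1) := by linarith
        _ ≤ _ := le_mul_of_one_le_right (by linarith) (one_le_pow₀ hq.le)
    · obtain ⟨k, rfl⟩ := Nat.exists_eq_add_of_le' hn
      have h1 := ih k (by omega)
      have h2 := hC k
      have h3 : 0 ≤ S * (q ^ m - 1) * q ^ k := by positivity
      rw [h k, Nat.cast_add, pow_add]
      generalize C / (q ^ m - 1) = D at *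
      subst hD
      linarith

lemma exists_not_subexponential_of_mem {b : A} (hb : ¬ Subexponential φ [b]) :
    ∃ c ∈ φ b, ¬ Subexponential φ [c] := by
  by_contra! hall
  refine hb fun q hq => ?_
  obtain ⟨C, hC⟩ := subexponential_of_forall_mem hall q hq
  have hC0 : 0 ≤ C := by simpa using (Nat.cast_nonneg _).trans (hC 0)
  refine ⟨C + 1, fun n => ?_⟩
  cases n with
  | zero => simpa [iterWord] using hC0
  | succ n =>
    rw [iterWord_succ, substWord_singleton]
    calc _ ≤ C * q ^ n := hC n
      _ ≤ (C + 1) * q ^ (n + 1) := by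
        gcongr
        · linarith
        · exact hq.le
        · omega

lemma exists_not_subexponential_mem_iterWord {w : List A}
    (hw : ∃ c ∈ w, ¬ Subexponential φ [c]) (n : ℕ) :
    ∃ c ∈ iterWord φ n w, ¬ Subexponential φ [c] := by
  induction n generalizing w with
  | zero => exact hw
  | succ n ih =>
    obtain ⟨c, hc, hcs⟩ := hw
    obtain ⟨d, hd, hds⟩ := exists_not_subexponential_of_mem hcs
    refine ih ⟨d, (sublist_iterWord_of_mem hc 1).subset ?_, hds⟩
    simpa [iterWord, substWord_singleton] using hd

lemma hasOrderInf_iff {b : A} :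
    HasOrderInf φ b ↔ ∃ q : ℝ, 1 < q ∧ ∃ (C : ℝ) (r : ℕ),
      ∀ n, q ^ n ≤ C * ((iterWord φ (n + r) [b]).length : ℝ) := by
  constructor
  · rintro ⟨q, hq, h⟩
    obtain ⟨C, hC⟩ := h.bound
    obtain ⟨r, hr⟩ := eventually_atTop.1 hC
    refine ⟨q, hq, C, r, fun n => ?_⟩
    have := hr (n + r) (by omega)
    rw [Real.norm_of_nonneg (by positivity), Real.norm_of_nonneg (by positivity)] at this
    exact (pow_le_pow_right₀ hq.le (by omega)).trans this
  · rintro ⟨q, hq, C, r, h⟩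
    refine ⟨q, hq, IsBigO.of_bound (q ^ r * C) ?_⟩
    filter_upwards [eventually_ge_atTop r] with n hn
    obtain ⟨k, rfl⟩ := Nat.exists_eq_add_of_le' hn
    rw [Real.norm_of_nonneg (by positivity), Real.norm_of_nonneg (by positivity), pow_add,
      mul_comm, mul_assoc]
    exact mul_le_mul_of_nonneg_left (h k) (by positivity)

lemma HasOrderInf.of_mem_iterWord {b c : A} {r : ℕ} (hc : c ∈ iterWord φ r [b])
    (h : HasOrderInf φ c) : HasOrderInf φ b := by
  obtain ⟨q, hq, C, s, hC⟩ := hasOrderInf_iff.1 h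
  have hC0 : 0 ≤ C := by
    by_contra! hneg
    have h0 := hC 0
    rw [pow_zero] at h0
    have := mul_nonpos_of_nonpos_of_nonneg hneg.le
      (Nat.cast_nonneg (α := ℝ) (iterWord φ (0 + s) [c]).length)
    linarith
  refine hasOrderInf_iff.2 ⟨q, hq, C, s + r, fun n => (hC n).trans ?_⟩
  rw [← add_assoc]
  gcongr
  exact length_le_of_mem_iterWord hc (n + s)

lemma hasOrderInf_of_two_mul_le (hφ : ∀ b, φ b ≠ []) {b : A} {m : ℕ} (hm : 0 < m)
    (h : ∀ n, 2 * (iterWord φ n [b]).length ≤ (iterWord φ (n + m) [b]).length) :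
    HasOrderInf φ b := by
  set q : ℝ := 2 ^ (1 / (m : ℝ)) with hqdef
  have hm' : (m : ℝ) ≠ 0 := by exact_mod_cast hm.ne'
  have hq : 1 < q := Real.one_lt_rpow (by norm_num) (by positivity)
  have hqm : q ^ m = 2 := by
    rw [hqdef, ← Real.rpow_natCast, ← Real.rpow_mul (by norm_num), one_div_mul_cancel hm',
      Real.rpow_one]
  refine hasOrderInf_iff.2 ⟨q, hq, 2, 0, fun n => ?_⟩
  rw [add_zero]
  induction n using Nat.strong_induction_on with
  | _ n ih =>
    rcases lt_or_ge n m with hn | hn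
    · have h1 : q ^ n ≤ 2 := hqm ▸ pow_le_pow_right₀ hq.le hn.le
      have h2 : (1 : ℝ) ≤ (iterWord φ n [b]).length := by
        exact_mod_cast length_iterWord_singleton_pos hφ b n
      linarith
    · obtain ⟨k, rfl⟩ := Nat.exists_eq_add_of_le' hn
      have h1 := ih k (by omega)
      have h2 : (2 : ℝ) * (iterWord φ k [b]).length ≤ (iterWord φ (k + m) [b]).length := by
        exact_mod_cast h k
      rw [pow_add, hqm]
      linarith

/-- The letters occurring in some iterated image of `b`. -/
def reach (φ : A → List A) (b : A) : Set A := {c | ∃ n, c ∈ iterWord φ n [b]}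

lemma mem_reach_self (b : A) : b ∈ reach φ b := ⟨0, List.mem_singleton_self b⟩

lemma reach_subset {b c : A} (h : c ∈ reach φ b) : reach φ c ⊆ reach φ b := by
  obtain ⟨n, hn⟩ := h
  rintro d ⟨m, hm⟩
  exact ⟨m + n, mem_iterWord_add hn hm⟩

lemma ncard_reach_lt [Finite A] {b c : A} (h : c ∈ reach φ b) (hb : b ∉ reach φ c) :
    (reach φ c).ncard < (reach φ b).ncard :=
  Set.ncard_lt_ncard ⟨reach_subset h, fun hs => hb (hs (mem_reach_self b))⟩ (Set.toFinite _)

/-- Growth dichotomy: a letter has either subexponential growth or order `∞`. -/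
theorem hasOrderInf_of_not_subexponential [Finite A] (hφ : ∀ b, φ b ≠ []) {b : A}
    (hb : ¬ Subexponential φ [b]) : HasOrderInf φ b := by
  induction hk : (reach φ b).ncard using Nat.strong_induction_on generalizing b with
  | _ k ih =>
    subst hk
    by_contra hinf
    have hsub : ∀ c ∈ reach φ b, b ∉ reach φ c → Subexponential φ [c] := by
      intro c hc hbc
      by_contra hcs
      obtain ⟨r, hr⟩ := hc
      exact hinf ((ih _ (ncard_reach_lt ⟨r, hr⟩ hbc) hcs rfl).of_mem_iterWord hr)
    by_cases hcyc : ∃ m, 0 < m ∧ b ∈ iterWord φ m [b]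
    · obtain ⟨m, hm, hbm⟩ := hcyc
      obtain ⟨s, t, hst⟩ := List.append_of_mem hbm
      have hlen : ∀ n, (iterWord φ (n + m) [b]).length =
          (iterWord φ n [b]).length + (iterWord φ n (s ++ t)).length := by
        intro n
        rw [iterWord_add, hst, iterWord_append, iterWord_cons, iterWord_append]
        simp only [List.length_append]
        omega
      refine hb (subexponential_of_length_add hm (subexponential_of_forall_mem ?_) hlen)
      intro c hc
      refine hsub c ⟨m, ?_⟩ ?_
      · rw [hst]
        simp only [List.mem_append, List.mem_cons] at hc ⊢
        tauto
      · rintro ⟨j, hj⟩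
        refine hinf (hasOrderInf_of_two_mul_le hφ (m := j + m) (by omega) fun n => ?_)
        have h1 := hlen (n + j)
        have h2 := (sublist_iterWord_of_mem (φ := φ) hc (n + j)).length_le
        have h3 := length_le_of_mem_iterWord hj n
        have h4 : (iterWord φ n [b]).length ≤ (iterWord φ (n + j) [b]).length :=
          length_iterWord_mono hφ [b] (Nat.le_add_right n j)
        rw [← add_assoc]
        omega
    · obtain ⟨c, hc, hcs⟩ := exists_not_subexponential_of_mem hb
      have hc1 : c ∈ iterWord φ 1 [b] := by simpa [iterWord, substWord_singleton] using hc
      refine hcs (hsub c ⟨1, hc1⟩ ?_)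
      rintro ⟨j, hj⟩
      exact hcyc ⟨j + 1, by omega, mem_iterWord_add hc1 hj⟩

lemma HasOrderInf.not_subexponential {b : A} (h : HasOrderInf φ b) :
    ¬ Subexponential φ [b] := by
  intro hs
  obtain ⟨q, hq, h⟩ := h
  have hp : 1 < √q := Real.lt_sqrt_of_sq_lt (by simpa using hq)
  obtain ⟨C, hC⟩ := hs _ hp
  have hO : (fun n : ℕ => q ^ n) =O[atTop] fun n : ℕ => √q ^ n := by
    refine h.trans (IsBigO.of_bound C (Eventually.of_forall fun n => ?_))
    rw [Real.norm_of_nonneg (by positivity), Real.norm_of_nonneg (by positivity)]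
    exact hC n
  have hlt : √q < q := by nlinarith [Real.mul_self_sqrt (zero_le_one.trans hq.le)]
  have ho := isLittleO_pow_pow_of_lt_left (Real.sqrt_nonneg q) hlt
  refine isLittleO_irrefl (Frequently.of_forall fun n => ?_) (hO.trans_isLittleO ho)
  positivity

end Growth

/-- If `a` is a letter of order `∞` with `φ(a) = aγ` (`γ` nonempty), then the
pure morphic sequence `α = φ^∞(a)` contains infinitely many occurrences of
letters of order `∞`. -/
theorem stmt16 {A : Type*} [Fintype A]
    (φ : A → List A) (hφ : ∀ b : A, φ b ≠ [])
    (a : A) (hainf : HasOrderInf φ a)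
    (γ : List A) (hγ : γ ≠ []) (ha : φ a = a :: γ)
    (α : ℕ → A)
    (hα : ∀ (n i : ℕ) (h : i < (iterWord φ n [a]).length),
      (iterWord φ n [a]).get ⟨i, h⟩ = α i) :
    ∀ N : ℕ, ∃ i : ℕ, N ≤ i ∧ HasOrderInf φ (α i) := by
  intro N
  have hsucc : ∀ n, iterWord φ (n + 1) [a] = iterWord φ n [a] ++ iterWord φ n γ := fun n => by
    rw [iterWord_succ, substWord_singleton, ha, iterWord_cons]
  have hγs : ∃ c ∈ γ, ¬ Subexponential φ [c] := by
    by_contra! hall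
    exact hainf.not_subexponential (subexponential_of_length_add one_pos
      (subexponential_of_forall_mem hall) fun n => by rw [hsucc, List.length_append])
  have hlen : ∀ n, n ≤ (iterWord φ n [a]).length := by
    intro n
    induction n with
    | zero => simp
    | succ n ih =>
      have h1 : γ.length ≤ (iterWord φ n γ).length :=
        length_iterWord_mono hφ γ (Nat.zero_le n)
      have h2 := List.length_pos_iff.2 hγ
      rw [hsucc, List.length_append]
      omega
  obtain ⟨c, hc, hcs⟩ := exists_not_subexponential_mem_iterWord hγs N
  obtain ⟨j, hj, rfl⟩ := List.getElem_of_mem hc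
  refine ⟨(iterWord φ N [a]).length + j, (hlen N).trans (Nat.le_add_right _ _), ?_⟩
  have hi : (iterWord φ N [a]).length + j < (iterWord φ (N + 1) [a]).length := by
    rw [hsucc, List.length_append]
    omega
  rw [← hα (N + 1) _ hi]
  refine hasOrderInf_of_not_subexponential hφ ?_
  simpa [hsucc] using hcs
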